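/- Pick's theorem for lattice triangles: let p, q, r be three affinely independent points of the integer lattice ℤ² (viewed in ℝ²), let T be the convex hull of {p, q, r}, let I be the number of lattice points in the topological interior of T and B be the number of lattice points in the topological frontier (boundary) of T. Then the two-dimensional Lebesgue measure (area) A of T satisfies A = I + B/2 − 1. -/

import Mathlib

open MeasureTheory

/-- The integer lattice `ℤ²`, viewed as a subset of the plane `ℝ²`. -/
def intLattice : Set (ℝ × ℝ) :=
  {x | ∃ z : ℤ × ℤ, ((z.1 : ℝ), (z.2 : ℝ)) = x}


lemma pick_solve {a b c d : ℤ} (hD : 0 < a * d - b * c) {x y x_b y_b : ℤ}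
    (h1 : x * d - y * c = x_b * d - y_b * c) (h2 : a * y - b * x = a * y_b - b * x_b) :
    x = x_b ∧ y = y_b := by
  constructor
  · apply mul_left_cancel₀ hD.ne'
    linear_combination a * h1 + c * h2
  · apply mul_left_cancel₀ hD.ne'
    linear_combination b * h1 + d * h2

/-- The linear map with columns `(a, b)` and `(c, d)`. -/
def pickMap (a b c d : ℤ) : (ℤ × ℤ) →ₗ[ℤ] (ℤ × ℤ) where
  toFun w := (w.1 * a + w.2 * c, w.1 * b + w.2 * d)
  map_add' x y := by ext <;> simp <;> ring
  map_smul' x y := by ext <;> simp <;> ring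

lemma pickMap_det (a b c d : ℤ) : LinearMap.det (pickMap a b c d) = a * d - b * c := by
  rw [← LinearMap.det_toMatrix (Module.Basis.finTwoProd ℤ), Matrix.det_fin_two]
  simp [LinearMap.toMatrix_apply, pickMap]
  ring

lemma pickMap_inj {a b c d : ℤ} (hD : 0 < a * d - b * c) :
    Function.Injective (pickMap a b c d) := by
  rintro ⟨x, y⟩ ⟨x_b, y_b⟩ h
  simp only [pickMap, LinearMap.coe_mk, AddHom.coe_mk, Prod.mk.injEq] at h
  obtain ⟨h1, h2⟩ := h
  have e1 : x = x_b := by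
    apply mul_left_cancel₀ hD.ne'
    linear_combination d * h1 - c * h2
  have e2 : y = y_b := by
    apply mul_left_cancel₀ hD.ne'
    linear_combination a * h2 - b * h1
  simp [e1, e2]

lemma pick_card_quot {a b c d : ℤ} (hD : 0 < a * d - b * c) :
    (Nat.card ((ℤ × ℤ) ⧸ LinearMap.range (pickMap a b c d)) : ℤ) = a * d - b * c := by
  have := Submodule.natAbs_det_equiv (LinearMap.range (pickMap a b c d))
    (LinearEquiv.ofInjective (pickMap a b c d) (pickMap_inj hD))
  rw [← this]
  have e : (LinearMap.range (pickMap a b c d)).subtype ∘ₗ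
      AddMonoidHom.toIntLinearMap ((LinearEquiv.ofInjective (pickMap a b c d) (pickMap_inj hD)) :
        (ℤ × ℤ) →+ LinearMap.range (pickMap a b c d)) = pickMap a b c d := by
    ext <;> rfl
  rw [e, pickMap_det]
  omega

lemma pick_card_para {a b c d : ℤ} (hD : 0 < a * d - b * c) :
    (Nat.card {w : ℤ × ℤ | (0 ≤ w.1 * d - w.2 * c ∧ w.1 * d - w.2 * c < a * d - b * c) ∧
      0 ≤ a * w.2 - b * w.1 ∧ a * w.2 - b * w.1 < a * d - b * c} : ℤ) = a * d - b * c := by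
  refine Eq.trans ?_ (pick_card_quot hD)
  congr 1
  apply Nat.card_eq_of_bijective (fun w => (LinearMap.range (pickMap a b c d)).mkQ w.1)
  constructor
  · rintro ⟨⟨x, y⟩, ⟨h1, h2⟩, h3, h4⟩ ⟨⟨x_b, y_b⟩, ⟨h1_b, h2_b⟩, h3_b, h4_b⟩ h
    simp only [Submodule.mkQ_apply, Submodule.Quotient.eq, LinearMap.mem_range] at h
    obtain ⟨⟨m, n⟩, h⟩ := h
    simp only [pickMap, LinearMap.coe_mk, AddHom.coe_mk, Prod.mk_sub_mk, Prod.mk.injEq] at h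
    obtain ⟨e1, e2⟩ := h
    dsimp only at h1 h2 h3 h4 h1_b h2_b h3_b h4_b
    have k1 : (a * d - b * c) * m = (x * d - y * c) - (x_b * d - y_b * c) := by
      linear_combination d * e1 - c * e2
    have k2 : (a * d - b * c) * n = (a * y - b * x) - (a * y_b - b * x_b) := by
      linear_combination a * e2 - b * e1
    have hm : m = 0 := by
      have : m < 1 := by nlinarith
      have : -1 < m := by nlinarith
      omega
    have hn : n = 0 := by
      have : n < 1 := by nlinarith
      have : -1 < n := by nlinarith
      omega
    subst hm hn
    simp only [Subtype.mk.injEq, Prod.mk.injEq]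
    constructor <;> linarith
  · intro z
    obtain ⟨⟨x, y⟩, rfl⟩ := Submodule.mkQ_surjective _ z
    set D := a * d - b * c with hDD
    set m := (x * d - y * c) / D with hm
    set n := (a * y - b * x) / D with hn
    have k1 := Int.emod_add_mul_ediv (x * d - y * c) D
    have k2 := Int.emod_add_mul_ediv (a * y - b * x) D
    have p1 := Int.emod_nonneg (x * d - y * c) hD.ne'
    have p2 := Int.emod_nonneg (a * y - b * x) hD.ne'
    have q1 := Int.emod_lt_of_pos (x * d - y * c) hD
    have q2 := Int.emod_lt_of_pos (a * y - b * x) hD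
    rw [← hm] at k1
    rw [← hn] at k2
    have r1 : (x - (m * a + n * c)) * d - (y - (m * b + n * d)) * c = (x * d - y * c) % D := by
      linear_combination -k1 + m * hDD
    have r2 : a * (y - (m * b + n * d)) - b * (x - (m * a + n * c)) = (a * y - b * x) % D := by
      linear_combination -k2 + n * hDD
    refine ⟨⟨(x - (m * a + n * c), y - (m * b + n * d)), ?_⟩, ?_⟩
    · simp only [Set.mem_ofPred_eq, r1, r2]
      exact ⟨⟨p1, q1⟩, p2, q2⟩
    · simp only [Submodule.mkQ_apply, Submodule.Quotient.eq, LinearMap.mem_range]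
      refine ⟨(-m, -n), ?_⟩
      simp only [pickMap, LinearMap.coe_mk, AddHom.coe_mk, Prod.mk_sub_mk, Prod.mk.injEq]
      constructor <;> ring

lemma pick_combi {a b c d D : ℤ} (hDD : D = a * d - b * c) (hD : 0 < D) :
    D = 2 * (Set.ncard {w : ℤ × ℤ | 0 < w.1 * d - w.2 * c ∧ 0 < a * w.2 - b * w.1 ∧
        (w.1 * d - w.2 * c) + (a * w.2 - b * w.1) < D} : ℤ) +
      (Set.ncard {w : ℤ × ℤ | (0 ≤ w.1 * d - w.2 * c ∧ 0 ≤ a * w.2 - b * w.1 ∧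
        (w.1 * d - w.2 * c) + (a * w.2 - b * w.1) ≤ D) ∧
        ¬ (0 < w.1 * d - w.2 * c ∧ 0 < a * w.2 - b * w.1 ∧
        (w.1 * d - w.2 * c) + (a * w.2 - b * w.1) < D)} : ℤ) - 2 := by
  classical
  have hpara := pick_card_para (hDD ▸ hD)
  rw [← hDD] at hpara
  let f : ℤ × ℤ → ℤ × ℤ := fun w => (w.1 * d - w.2 * c, a * w.2 - b * w.1)
  have hf : Function.Injective f := by
    rintro ⟨x, y⟩ ⟨x_b, y_b⟩ h
    simp only [f, Prod.mk.injEq] at h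
    have := pick_solve (hDD ▸ hD) h.1 h.2
    simp [this.1, this.2]
  have hfin : (f ⁻¹' (Set.Icc 0 D ×ˢ Set.Icc 0 D)).Finite :=
    ((Set.finite_Icc 0 D).prod (Set.finite_Icc 0 D)).preimage hf.injOn
  set G := hfin.toFinset with hG
  have memG : ∀ w, w ∈ G ↔ (0 ≤ (f w).1 ∧ (f w).1 ≤ D) ∧ 0 ≤ (f w).2 ∧ (f w).2 ≤ D := by
    intro w; simp only [hG, Set.Finite.mem_toFinset]; rfl
  have key : ∀ P : ℤ × ℤ → Prop, (∀ w, P w → w ∈ G) →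
      (Set.ncard {w | P w} : ℤ) = ∑ w ∈ G, if P w then (1 : ℤ) else 0 := by
    intro P hP
    rw [Finset.sum_boole, ← Set.ncard_coe_finset]
    congr 2
    ext w
    simp only [Set.mem_ofPred_eq, Finset.coe_filter]
    exact ⟨fun h => ⟨hP w h, h⟩, fun h => h.2⟩
  have one : ∀ s t x y : ℤ, f (x, y) = (s, t) →
      (Set.ncard {w | (f w).1 = s ∧ (f w).2 = t} : ℤ) = 1 := by
    intro s t x y h
    have : {w | (f w).1 = s ∧ (f w).2 = t} = {(x, y)} := by
      ext w
      simp only [Set.mem_ofPred_eq, Set.mem_singleton_iff]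
      rw [← hf.eq_iff, h, Prod.ext_iff]
    rw [this]; simp
  have hu := one D 0 a b (by simp only [f, Prod.mk.injEq]; constructor <;> [skip; ring]; rw [hDD])
  have hv := one 0 D c d (by simp only [f, Prod.mk.injEq]; constructor <;> [ring; skip]; rw [hDD])
  have hsym : (Set.ncard {w | 0 < (f w).1 ∧ 0 < (f w).2 ∧ (f w).1 + (f w).2 < D}) =
      (Set.ncard {w | (f w).1 < D ∧ (f w).2 < D ∧ D < (f w).1 + (f w).2}) := by
    apply Set.ncard_congr (fun w _ => (a + c - w.1, b + d - w.2))
    · rintro ⟨x, y⟩ ⟨h1, h2, h3⟩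
      simp only [f, Set.mem_ofPred_eq] at *
      refine ⟨?_, ?_, ?_⟩ <;> nlinarith
    · rintro ⟨x, y⟩ ⟨x_b, y_b⟩ _ _ h
      simp only [Prod.mk.injEq] at *
      omega
    · rintro ⟨x, y⟩ ⟨h1, h2, h3⟩
      refine ⟨(a + c - x, b + d - y), ?_, by simp⟩
      simp only [f, Set.mem_ofPred_eq] at *
      refine ⟨?_, ?_, ?_⟩ <;> nlinarith
  change (Set.ncard {w | (0 ≤ (f w).1 ∧ (f w).1 < D) ∧ 0 ≤ (f w).2 ∧ (f w).2 < D} : ℤ) = D at hpara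
  change D = 2 * (Set.ncard {w | 0 < (f w).1 ∧ 0 < (f w).2 ∧ (f w).1 + (f w).2 < D} : ℤ) +
    (Set.ncard {w | (0 ≤ (f w).1 ∧ 0 ≤ (f w).2 ∧ (f w).1 + (f w).2 ≤ D) ∧
      ¬ (0 < (f w).1 ∧ 0 < (f w).2 ∧ (f w).1 + (f w).2 < D)} : ℤ) - 2
  have main : (Set.ncard {w | (0 ≤ (f w).1 ∧ (f w).1 < D) ∧ 0 ≤ (f w).2 ∧ (f w).2 < D} : ℤ) +
      (Set.ncard {w | (f w).1 = D ∧ (f w).2 = 0} : ℤ) +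
      (Set.ncard {w | (f w).1 = 0 ∧ (f w).2 = D} : ℤ) =
      (Set.ncard {w | 0 < (f w).1 ∧ 0 < (f w).2 ∧ (f w).1 + (f w).2 < D} : ℤ) +
      (Set.ncard {w | (f w).1 < D ∧ (f w).2 < D ∧ D < (f w).1 + (f w).2} : ℤ) +
      (Set.ncard {w | (0 ≤ (f w).1 ∧ 0 ≤ (f w).2 ∧ (f w).1 + (f w).2 ≤ D) ∧
      ¬ (0 < (f w).1 ∧ 0 < (f w).2 ∧ (f w).1 + (f w).2 < D)} : ℤ) := by
    rw [key _ (by intro w; rw [memG]; omega), key _ (by intro w; rw [memG]; omega),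
      key _ (by intro w; rw [memG]; omega), key _ (by intro w; rw [memG]; omega),
      key _ (by intro w; rw [memG]; omega), key _ (by intro w; rw [memG]; omega)]
    simp only [← Finset.sum_add_distrib]
    apply Finset.sum_congr rfl
    intro w hw
    rw [memG] at hw
    generalize (f w).1 = s at *
    generalize (f w).2 = t at *
    split_ifs <;> omega
  omega

lemma pick_interior_half (α β γ : ℝ) (h : ¬ (α = 0 ∧ β = 0)) :
    interior {x : ℝ × ℝ | 0 ≤ α * x.1 + β * x.2 + γ} = {x | 0 < α * x.1 + β * x.2 + γ} := by
  let L : (ℝ × ℝ) →L[ℝ] ℝ :=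
    α • ContinuousLinearMap.fst ℝ ℝ ℝ + β • ContinuousLinearMap.snd ℝ ℝ ℝ
  have hL : ∀ x, L x = α * x.1 + β * x.2 := fun x => by simp [L]
  have hs : Function.Surjective L := by
    intro y
    have h0 : α ^ 2 + β ^ 2 ≠ 0 := by
      intro h0
      exact h ⟨by nlinarith [sq_nonneg α, sq_nonneg β], by nlinarith [sq_nonneg α, sq_nonneg β]⟩
    refine ⟨(y * α / (α ^ 2 + β ^ 2), y * β / (α ^ 2 + β ^ 2)), ?_⟩
    rw [hL]
    field_simp
  have e1 : {x : ℝ × ℝ | 0 ≤ α * x.1 + β * x.2 + γ} = L ⁻¹' Set.Ici (-γ) := by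
    ext x
    simp only [Set.mem_ofPred_eq, Set.mem_preimage, Set.mem_Ici, hL]
    constructor <;> intro _ <;> linarith
  rw [e1, L.interior_preimage hs, interior_Ici]
  ext x
  simp only [Set.mem_ofPred_eq, Set.mem_preimage, Set.mem_Ioi, hL]
  constructor <;> intro _ <;> linarith

lemma pick_vol_std (D : ℝ) (hD : 0 < D) :
    volume {x : ℝ × ℝ | 0 ≤ x.1 ∧ 0 ≤ x.2 ∧ x.1 + x.2 ≤ D} = ENNReal.ofReal (D ^ 2 / 2) := by
  have hm : MeasurableSet {x : ℝ × ℝ | 0 ≤ x.1 ∧ 0 ≤ x.2 ∧ x.1 + x.2 ≤ D} := by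
    apply IsClosed.measurableSet
    simp only [Set.ofPred_and]
    exact (isClosed_le (by fun_prop) (by fun_prop)).inter
      ((isClosed_le (by fun_prop) (by fun_prop)).inter (isClosed_le (by fun_prop) (by fun_prop)))
  rw [Measure.volume_eq_prod, Measure.prod_apply hm]
  have e : ∀ x : ℝ, volume (Prod.mk x ⁻¹' {x : ℝ × ℝ | 0 ≤ x.1 ∧ 0 ≤ x.2 ∧ x.1 + x.2 ≤ D}) =
      (Set.Icc 0 D).indicator (fun x => ENNReal.ofReal (D - x)) x := by
    intro x
    by_cases hx : x ∈ Set.Icc 0 D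
    · rw [Set.indicator_of_mem hx]
      have : Prod.mk x ⁻¹' {x : ℝ × ℝ | 0 ≤ x.1 ∧ 0 ≤ x.2 ∧ x.1 + x.2 ≤ D} =
          Set.Icc 0 (D - x) := by
        ext y
        simp only [Set.mem_preimage, Set.mem_ofPred_eq, Set.mem_Icc]
        constructor
        · rintro ⟨_, h2, h3⟩; exact ⟨h2, by linarith⟩
        · rintro ⟨h2, h3⟩; exact ⟨hx.1, h2, by linarith⟩
      rw [this, Real.volume_Icc, sub_zero]
    · rw [Set.indicator_of_notMem hx]
      have : Prod.mk x ⁻¹' {x : ℝ × ℝ | 0 ≤ x.1 ∧ 0 ≤ x.2 ∧ x.1 + x.2 ≤ D} = ∅ := by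
        ext y
        simp only [Set.mem_preimage, Set.mem_ofPred_eq, Set.mem_empty_iff_false, iff_false]
        rintro ⟨h1, h2, h3⟩
        exact hx ⟨h1, by linarith⟩
      rw [this, measure_empty]
  simp_rw [e]
  rw [lintegral_indicator measurableSet_Icc, ← ofReal_integral_eq_lintegral_ofReal]
  · congr 1
    rw [integral_Icc_eq_integral_Ioc, ← intervalIntegral.integral_of_le hD.le,
      intervalIntegral.integral_sub (by simp) (by simp), integral_id,
      intervalIntegral.integral_const, smul_eq_mul]
    ring
  · exact (by fun_prop : Continuous fun x : ℝ => D - x).integrableOn_Icc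
  · rw [Filter.EventuallyLE, ae_restrict_iff' measurableSet_Icc]
    filter_upwards with x hx
    simpa using hx.2

/-- The coordinate map. -/
def pickCoord (a b c d : ℝ) : (ℝ × ℝ) →ₗ[ℝ] (ℝ × ℝ) where
  toFun w := (w.1 * d - w.2 * c, a * w.2 - b * w.1)
  map_add' x y := by ext <;> simp <;> ring
  map_smul' x y := by ext <;> simp <;> ring

lemma pickCoord_det (a b c d : ℝ) : LinearMap.det (pickCoord a b c d) = a * d - b * c := by
  rw [← LinearMap.det_toMatrix (Module.Basis.finTwoProd ℝ), Matrix.det_fin_two]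
  simp [LinearMap.toMatrix_apply, pickCoord]
  ring

/-- The closed triangle in coordinates. -/
def pickTri (x y a b c d D : ℝ) : Set (ℝ × ℝ) :=
  {w | 0 ≤ (w.1 - x) * d - (w.2 - y) * c ∧ 0 ≤ a * (w.2 - y) - b * (w.1 - x) ∧
    ((w.1 - x) * d - (w.2 - y) * c) + (a * (w.2 - y) - b * (w.1 - x)) ≤ D}

lemma pickTri_vol (x y a b c d D : ℝ) (hDD : D = a * d - b * c) (hD : 0 < D) :
    (volume (pickTri x y a b c d D)).toReal = D / 2 := by
  have e : pickTri x y a b c d D = (fun w => w + (-x, -y)) ⁻¹' (pickCoord a b c d ⁻¹'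
      {x : ℝ × ℝ | 0 ≤ x.1 ∧ 0 ≤ x.2 ∧ x.1 + x.2 ≤ D}) := rfl
  rw [e, measure_preimage_add_right, Measure.addHaar_preimage_linearMap, pickCoord_det,
    pick_vol_std D hD, ← hDD, ← ENNReal.ofReal_mul (by positivity), ENNReal.toReal_ofReal (by positivity),
    abs_of_pos (by positivity)]
  · field_simp
  · rw [pickCoord_det]; rw [← hDD]; exact hD.ne'

lemma pickTri_interior (x y a b c d D : ℝ) (hDD : D = a * d - b * c) (hD : 0 < D) :
    interior (pickTri x y a b c d D) =
    {w | 0 < (w.1 - x) * d - (w.2 - y) * c ∧ 0 < a * (w.2 - y) - b * (w.1 - x) ∧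
    ((w.1 - x) * d - (w.2 - y) * c) + (a * (w.2 - y) - b * (w.1 - x)) < D} := by
  have e : pickTri x y a b c d D = {w | 0 ≤ d * w.1 + (-c) * w.2 + (-x * d + y * c)} ∩
      ({w | 0 ≤ (-b) * w.1 + a * w.2 + (b * x - a * y)} ∩
      {w | 0 ≤ (b - d) * w.1 + (c - a) * w.2 + (D + x * d - y * c + a * y - b * x)}) := by
    ext w
    simp only [pickTri, Set.mem_ofPred_eq, Set.mem_inter_iff]
    refine and_congr ?_ (and_congr ?_ ?_) <;> constructor <;> intro _ <;> linarith
  rw [e, interior_inter, interior_inter, pick_interior_half, pick_interior_half, pick_interior_half]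
  · ext w
    simp only [Set.mem_ofPred_eq, Set.mem_inter_iff]
    refine and_congr ?_ (and_congr ?_ ?_) <;> constructor <;> intro _ <;> linarith
  · rintro ⟨h1, h2⟩
    obtain rfl : b = d := by linarith
    obtain rfl : c = a := by linarith
    nlinarith
  · rintro ⟨h1, h2⟩
    obtain rfl : b = 0 := by linarith
    subst h2
    nlinarith
  · rintro ⟨h1, h2⟩
    obtain rfl : c = 0 := by linarith
    subst h1
    nlinarith

lemma pickTri_closed (x y a b c d D : ℝ) : IsClosed (pickTri x y a b c d D) := by
  simp only [pickTri, Set.ofPred_and]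
  exact (isClosed_le (by fun_prop) (by fun_prop)).inter
    ((isClosed_le (by fun_prop) (by fun_prop)).inter (isClosed_le (by fun_prop) (by fun_prop)))

lemma pickTri_hull (x y a b c d D : ℝ) (hDD : D = a * d - b * c) (hD : 0 < D) :
    convexHull ℝ {(x, y), (x + a, y + b), (x + c, y + d)} = pickTri x y a b c d D := by
  apply Set.Subset.antisymm
  · apply convexHull_min
    · rintro w (rfl | rfl | rfl) <;> refine ⟨?_, ?_, ?_⟩ <;> ring_nf <;> nlinarith
    · rintro ⟨u1, u2⟩ ⟨h1, h2, h3⟩ ⟨v1, v2⟩ ⟨k1, k2, k3⟩ s t hs ht hst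
      obtain rfl : t = 1 - s := by linarith
      simp only [pickTri, Set.mem_ofPred_eq, Prod.smul_mk, Prod.mk_add_mk, smul_eq_mul] at *
      have i1 := mul_nonneg hs h1
      have i2 := mul_nonneg hs h2
      have i3 := mul_le_mul_of_nonneg_left h3 hs
      have j1 := mul_nonneg ht k1
      have j2 := mul_nonneg ht k2
      have j3 := mul_le_mul_of_nonneg_left k3 ht
      refine ⟨?_, ?_, ?_⟩ <;> linarith
  · rintro ⟨u, v⟩ ⟨h1, h2, h3⟩
    dsimp only at h1 h2 h3
    set S := (u - x) * d - (v - y) * c with hS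
    set U := a * (v - y) - b * (u - x) with hU
    have hc := convex_convexHull ℝ ({(x, y), (x + a, y + b), (x + c, y + d)} : Set (ℝ × ℝ))
    have m : ∀ i : Fin 3, (![(x, y), (x + a, y + b), (x + c, y + d)] : Fin 3 → ℝ × ℝ) i ∈
        convexHull ℝ ({(x, y), (x + a, y + b), (x + c, y + d)} : Set (ℝ × ℝ)) := by
      intro i
      apply subset_convexHull
      fin_cases i <;> simp
    have := hc.sum_mem (t := Finset.univ) (w := ![(D - S - U) / D, S / D, U / D])
      (z := ![(x, y), (x + a, y + b), (x + c, y + d)])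
      (by
        intro i _
        fin_cases i
        · exact div_nonneg (by linarith) hD.le
        · exact div_nonneg (by linarith) hD.le
        · exact div_nonneg (by linarith) hD.le)
      (by simp only [Fin.sum_univ_three]; simp; field_simp; ring)
      (fun i _ => m i)
    convert this using 1
    simp only [Fin.sum_univ_three]
    simp
    constructor
    · field_simp
      rw [hS, hU, hDD]; ring
    · field_simp
      rw [hS, hU, hDD]; ring

lemma pick_ncard_lattice (x y : ℤ) (A : Set (ℝ × ℝ)) (P : ℤ × ℤ → Prop)
    (h : ∀ w : ℤ × ℤ, (((x + w.1 : ℤ) : ℝ), ((y + w.2 : ℤ) : ℝ)) ∈ A ↔ P w) :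
    (A ∩ intLattice).ncard = {w | P w}.ncard := by
  symm
  apply Set.ncard_congr (fun w _ => (((x + w.1 : ℤ) : ℝ), ((y + w.2 : ℤ) : ℝ)))
  · intro w hw
    exact ⟨(h w).2 hw, ⟨(x + w.1, y + w.2), rfl⟩⟩
  · rintro ⟨u, v⟩ ⟨u_b, v_b⟩ _ _ e
    simp only [Prod.mk.injEq, Int.cast_inj] at e ⊢
    omega
  · rintro w ⟨hw, ⟨⟨u, v⟩, rfl⟩⟩
    refine ⟨(u - x, v - y), ?_, ?_⟩
    · rw [Set.mem_ofPred_eq, ← h]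
      simpa using hw
    · simp

lemma pick_pos (x y a b c d D : ℤ) (hDD : D = a * d - b * c) (hD : 0 < D) (T : Set (ℝ × ℝ))
    (hT : T = convexHull ℝ {((x : ℝ), (y : ℝ)), ((x : ℝ) + a, (y : ℝ) + b),
      ((x : ℝ) + c, (y : ℝ) + d)}) :
    (volume T).toReal = ((interior T ∩ intLattice).ncard : ℝ) +
      ((frontier T ∩ intLattice).ncard : ℝ) / 2 - 1 := by
  have hDD_b : (D : ℝ) = a * d - b * c := by exact_mod_cast hDD
  have hD_b : (0 : ℝ) < D := by exact_mod_cast hD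
  rw [pickTri_hull x y a b c d D hDD_b hD_b] at hT
  subst hT
  rw [pickTri_vol x y a b c d D hDD_b hD_b, (pickTri_closed x y a b c d D).frontier_eq,
    pickTri_interior x y a b c d D hDD_b hD_b]
  have key := pick_combi hDD hD
  rw [pick_ncard_lattice x y _ (fun w => 0 < w.1 * d - w.2 * c ∧ 0 < a * w.2 - b * w.1 ∧
        (w.1 * d - w.2 * c) + (a * w.2 - b * w.1) < D),
    pick_ncard_lattice x y _ (fun w => (0 ≤ w.1 * d - w.2 * c ∧ 0 ≤ a * w.2 - b * w.1 ∧
        (w.1 * d - w.2 * c) + (a * w.2 - b * w.1) ≤ D) ∧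
        ¬ (0 < w.1 * d - w.2 * c ∧ 0 < a * w.2 - b * w.1 ∧
        (w.1 * d - w.2 * c) + (a * w.2 - b * w.1) < D))]
  · have key_b := congrArg (fun z : ℤ => (z : ℝ)) key
    push_cast at key_b
    linarith
  · intro w
    simp only [pickTri, Set.mem_sdiff, Set.mem_ofPred_eq]
    push_cast
    simp only [add_sub_cancel_left]
    norm_cast
  · intro w
    simp only [Set.mem_ofPred_eq]
    push_cast
    simp only [add_sub_cancel_left]
    norm_cast

/-- Pick's theorem for lattice triangles: if `T` is the convex hull of three
affinely independent lattice points, `I` the number of lattice points in the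
interior of `T` and `B` the number of lattice points on the frontier of `T`,
then the area of `T` is `I + B / 2 - 1`. -/
theorem pick_theorem_lattice_triangle (p q r : ℤ × ℤ)
    (h : AffineIndependent ℝ ![((p.1 : ℝ), (p.2 : ℝ)), ((q.1 : ℝ), (q.2 : ℝ)),
      ((r.1 : ℝ), (r.2 : ℝ))])
    (T : Set (ℝ × ℝ))
    (hT : T = convexHull ℝ {((p.1 : ℝ), (p.2 : ℝ)), ((q.1 : ℝ), (q.2 : ℝ)),
      ((r.1 : ℝ), (r.2 : ℝ))})
    (I B : ℕ)
    (hI : I = (interior T ∩ intLattice).ncard)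
    (hB : B = (frontier T ∩ intLattice).ncard) :
    (volume T).toReal = (I : ℝ) + (B : ℝ) / 2 - 1 := by
  subst hI hB
  obtain ⟨x, y⟩ := p
  obtain ⟨x_b, y_b⟩ := q
  obtain ⟨x_c, y_c⟩ := r
  dsimp only at h hT
  rcases lt_trichotomy ((x_b - x) * (y_c - y) - (y_b - y) * (x_c - x)) 0 with hD | hD | hD
  · apply pick_pos x y (x_c - x) (y_c - y) (x_b - x) (y_b - y) _ rfl (by linarith) T
    rw [hT]
    push_cast
    simp only [add_sub_cancel]
    rw [Set.pair_comm]
  · exfalso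
    have hD_b : ((x_b : ℝ) - x) * (y_c - y) - (y_b - y) * (x_c - x) = 0 := by exact_mod_cast hD
    rw [affineIndependent_iff_linearIndependent_vsub ℝ _ (0 : Fin 3)] at h
    have h2 := h.comp (![⟨1, by decide⟩, ⟨2, by decide⟩] : Fin 2 → {i : Fin 3 // i ≠ 0})
      (by decide)
    rw [Fintype.linearIndependent_iff] at h2
    have g1 := h2 ![(y_c : ℝ) - y, -((y_b : ℝ) - y)] (by
      simp [Fin.sum_univ_two]
      constructor <;> linarith)
    have g2 := h2 ![(x_c : ℝ) - x, -((x_b : ℝ) - x)] (by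
      simp [Fin.sum_univ_two]
      constructor <;> linarith)
    have e1 := g1 1
    have e2 := g2 1
    simp at e1 e2
    have g3 := h2 ![1, 0] (by
      simp [Fin.sum_univ_two]
      constructor <;> linarith)
    simpa using g3 0
  · apply pick_pos x y (x_b - x) (y_b - y) (x_c - x) (y_c - y) _ rfl hD T
    rw [hT]
    push_cast
    simp only [add_sub_cancel]
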